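/- arXiv:2509.06423 — 5 statements merged into one kernel-verified Lean document; each statement's English description precedes it below -/
import Mathlib

section
/- Let f(Y) = a_0 + a_1·Y + ⋯ + a_d·Y^d ∈ K[Y] be a polynomial of degree at most d, let n ∈ ℤ, and let y_0, y_1, …, y_d ∈ K be points such that v(y_k) = n for all k and v(y_k − y_l) = n for all k ≠ l. Then for every j with 0 ≤ j ≤ d one has v(a_j) ≥ min_{0 ≤ k ≤ d} v(f(y_k)) − n·j. -/
section

variable {K Γ : Type*} [Field K] [LinearOrderedAddCommMonoidWithTop Γ]
  (v : AddValuation K Γ) {t : K}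

open Polynomial

lemma AddValuation.add_le_map_coeff_mul_mul_pow {p q : K[X]} {a b : Γ}
    (hp : ∀ j, a ≤ v (p.coeff j * t ^ j)) (hq : ∀ j, b ≤ v (q.coeff j * t ^ j)) (j : ℕ) :
    a + b ≤ v ((p * q).coeff j * t ^ j) := by
  rw [coeff_mul, Finset.sum_mul]
  refine v.map_le_sum fun x hx => ?_
  rw [← Finset.HasAntidiagonal.mem_antidiagonal.mp hx, pow_add, mul_mul_mul_comm, v.map_mul]
  exact add_le_add (hp _) (hq _)

lemma AddValuation.zero_le_map_coeff_prod_mul_pow {ι : Type*} (s : Finset ι) (p : ι → K[X])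
    (hp : ∀ i ∈ s, ∀ j, 0 ≤ v ((p i).coeff j * t ^ j)) (j : ℕ) :
    0 ≤ v ((∏ i ∈ s, p i).coeff j * t ^ j) := by
  revert j
  refine Finset.prod_induction p (fun q => ∀ j, 0 ≤ v (q.coeff j * t ^ j)) ?_ ?_ hp
  · intro q r hq hr j
    simpa using v.add_le_map_coeff_mul_mul_pow hq hr j
  · rintro (_ | j) <;> simp [coeff_one]

lemma AddValuation.zero_le_map_coeff_basisDivisor_mul_pow {a b : K} (ht : v t = v (a - b))
    (hb : v b = v (a - b)) (hab : a ≠ b) (j : ℕ) :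
    0 ≤ v ((Lagrange.basisDivisor a b).coeff j * t ^ j) := by
  have h : v (a - b)⁻¹ + v (a - b) = 0 := by
    rw [← v.map_mul, inv_mul_cancel₀ (sub_ne_zero.mpr hab), v.map_one]
  rw [Lagrange.basisDivisor, coeff_C_mul]
  rcases j with _ | _ | j
  · simp [hb, h]
  · simp [coeff_X, ht, h]
  · simp [coeff_X]

lemma AddValuation.le_map_coeff_mul_pow_of_le_map_eval {ι : Type*} [DecidableEq ι] (s : Finset ι)
    {f : K[X]} (hf : f.degree < s.card) {y : ι → K} (hinj : Set.InjOn y s)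
    (hy : ∀ k ∈ s, v (y k) = v t)
    (hyy : ∀ k ∈ s, ∀ l ∈ s, k ≠ l → v (y k - y l) = v t) {a : Γ}
    (ha : ∀ k ∈ s, a ≤ v (f.eval (y k))) (j : ℕ) :
    a ≤ v (f.coeff j * t ^ j) := by
  rw [Lagrange.eq_interpolate hinj hf, Lagrange.interpolate_apply, finsetSum_coeff,
    Finset.sum_mul]
  refine v.map_le_sum fun k hk => ?_
  rw [coeff_C_mul, mul_assoc, v.map_mul, ← add_zero a]
  refine add_le_add (ha k hk) (v.zero_le_map_coeff_prod_mul_pow _ _ (fun l hl => ?_) j)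
  obtain ⟨hlk, hl⟩ := Finset.mem_erase.mp hl
  have hkl := hyy k hk l hl hlk.symm
  exact v.zero_le_map_coeff_basisDivisor_mul_pow hkl.symm ((hy l hl).trans hkl.symm)
    (hinj.ne hk hl hlk.symm)

end


/-- Interpolation lemma: if `f` has degree at most `d` and `y₀, …, y_d` all have
valuation `n` with pairwise differences of valuation `n`, then each coefficient
satisfies `v (a_j) ≥ min_k v (f (y_k)) - n * j` (stated additively as
`min_k v (f (y_k)) ≤ v (a_j) + n * j`). -/
theorem stmt0 {K : Type*} [Field K] (v : AddValuation K (WithTop ℤ))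
    (d : ℕ) (f : Polynomial K) (hdeg : f.natDegree ≤ d) (n : ℤ)
    (y : Fin (d + 1) → K)
    (hy : ∀ k, v (y k) = (n : WithTop ℤ))
    (hyy : ∀ k l, k ≠ l → v (y k - y l) = (n : WithTop ℤ))
    (j : ℕ) (hj : j ≤ d) :
    (Finset.univ.inf' Finset.univ_nonempty fun k : Fin (d + 1) => v (f.eval (y k)))
      ≤ v (f.coeff j) + ((n * j : ℤ) : WithTop ℤ) := by
  have hinj : Function.Injective y := fun k l hkl => by
    by_contra hne
    simpa [hkl] using hyy k l hne
  have hcoeff := v.le_map_coeff_mul_pow_of_le_map_eval (t := y 0) Finset.univ (f := f) (y := y)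
    (a := Finset.univ.inf' Finset.univ_nonempty fun k => v (f.eval (y k)))
    (by
      rw [Finset.card_univ, Fintype.card_fin]
      exact Polynomial.degree_le_natDegree.trans_lt (by exact_mod_cast Nat.lt_succ_of_le hdeg))
    hinj.injOn (fun k _ => (hy k).trans (hy 0).symm)
    (fun k _ l _ hkl => (hyy k l hkl).trans (hy 0).symm)
    (fun _ hk => Finset.inf'_le (fun k => v (f.eval (y k))) hk) j
  have hpow : v (y 0 ^ j) = ((n * j : ℤ) : WithTop ℤ) := by
    rw [v.map_pow, hy, ← WithTop.coe_nsmul, nsmul_eq_mul, mul_comm]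
  rwa [v.map_mul, hpow] at hcoeff
end

section
/- Let n, B ∈ ℤ, let y_0, …, y_d ∈ K satisfy v(y_k) ≥ n for all k, and let c_0, …, c_d ∈ K satisfy v(c_k) ≥ B for all k. Fix j with 0 ≤ j ≤ d and let M_j be the (d+1)×(d+1) matrix whose (k,i) entry equals y_k^i for i ≠ j and equals c_k for i = j (the Vandermonde matrix with its j-th column replaced by the vector (c_k)). Then v(det M_j) ≥ B + n·(d(d+1)/2 − j). -/
theorem AddValuation.sum_le_map_prod {R ι : Type*} [CommRing R]
    (v : AddValuation R (WithTop ℤ)) (s : Finset ι) (f : ι → R) (b : ι → ℤ)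
    (h : ∀ i ∈ s, (b i : WithTop ℤ) ≤ v (f i)) :
    ((∑ i ∈ s, b i : ℤ) : WithTop ℤ) ≤ v (∏ i ∈ s, f i) := by
  classical
  induction s using Finset.induction_on with
  | empty => simp
  | insert a s ha ih =>
    rw [Finset.sum_insert ha, Finset.prod_insert ha, v.map_mul, WithTop.coe_add]
    exact add_le_add (h a (Finset.mem_insert_self a s))
      (ih fun i hi => h i (Finset.mem_insert_of_mem hi))

theorem AddValuation.le_map_pow {R : Type*} [CommRing R]
    (v : AddValuation R (WithTop ℤ)) {n : ℤ} {x : R} (h : (n : WithTop ℤ) ≤ v x) (m : ℕ) :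
    ((n * m : ℤ) : WithTop ℤ) ≤ v (x ^ m) := by
  simpa [mul_comm] using
    v.sum_le_map_prod (Finset.range m) (fun _ => x) (fun _ => n) fun _ _ => h

/-- A determinant whose `i`-th column has valuation at least `b i` has valuation at least
`∑ i, b i`. -/
theorem AddValuation.sum_le_map_det {R ι : Type*} [CommRing R] [Fintype ι] [DecidableEq ι]
    (v : AddValuation R (WithTop ℤ)) (M : Matrix ι ι R) (b : ι → ℤ)
    (h : ∀ k i, (b i : WithTop ℤ) ≤ v (M k i)) :
    ((∑ i, b i : ℤ) : WithTop ℤ) ≤ v M.det := by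
  rw [Matrix.det_apply]
  refine v.map_le_sum fun σ _ => ?_
  have hprod := v.sum_le_map_prod Finset.univ (fun i => M (σ i) i) b fun i _ => h (σ i) i
  rcases Int.units_eq_one_or (Equiv.Perm.sign σ) with hσ | hσ <;> rw [hσ]
  · simpa using hprod
  · simpa [Units.smul_def, v.map_neg] using hprod

theorem Fin.sum_univ_val_succ (d : ℕ) :
    ∑ i : Fin (d + 1), (i : ℕ) = d * (d + 1) / 2 := by
  rw [Fin.sum_univ_eq_sum_range (fun i => i), Finset.sum_range_id, Nat.add_sub_cancel, mul_comm]

/-- Valuation bound for the Vandermonde matrix with its `j`-th column replaced: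
`v (det M_j) ≥ B + n * (d * (d + 1) / 2 - j)`. -/
theorem stmt4 {K : Type*} [Field K] (v : AddValuation K (WithTop ℤ))
    (d : ℕ) (n B : ℤ) (y : Fin (d + 1) → K) (c : Fin (d + 1) → K)
    (hy : ∀ k, (n : WithTop ℤ) ≤ v (y k))
    (hc : ∀ k, (B : WithTop ℤ) ≤ v (c k))
    (j : Fin (d + 1)) :
    ((B + n * (((d * (d + 1) / 2 : ℕ) : ℤ) - (j : ℤ)) : ℤ) : WithTop ℤ) ≤
      v (Matrix.of fun k i : Fin (d + 1) =>
          if i = j then c k else y k ^ (i : ℕ)).det := by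
  have hsum : B + n * (((d * (d + 1) / 2 : ℕ) : ℤ) - (j : ℤ)) =
      ∑ i : Fin (d + 1), if i = j then B else n * (i : ℕ) := by
    rw [← Fin.sum_univ_val_succ, ← Finset.add_sum_erase _ _ (Finset.mem_univ j),
      ← Finset.add_sum_erase Finset.univ _ (Finset.mem_univ j), if_pos rfl,
      Finset.sum_congr rfl fun i hi => if_neg (Finset.ne_of_mem_erase hi), ← Finset.mul_sum]
    push_cast
    ring
  rw [hsum]
  refine v.sum_le_map_det _ _ fun k i => ?_
  rw [Matrix.of_apply]
  split_ifs
  · exact hc k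
  · exact v.le_map_pow (hy k) i
end

section
/- Let n ≥ 0 and 0 ≤ C ≤ D be integers, and let r_1, …, r_D ∈ K satisfy v(r_m) ≥ 0 for all m. Suppose there is a subset S ⊆ {1, …, D} with #S = C such that v(r_m) ≥ n for all m ∈ S. Let f(X) = ∏_{m=1}^{D} (X − r_m) ∈ K[X]. Then for every i with 0 ≤ i ≤ D, the coefficient of X^i in f has valuation at least n·(C − i). -/
open Polynomial in
/-- Multiplying by `X - a` raises the linear lower bound `n * (c - i)` on the valuations of the
coefficients by `n * e`, provided `e ≤ 1` and `v a ≥ n * e`. -/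
theorem AddValuation.le_coeff_X_sub_C_mul {K : Type*} [Field K] (v : AddValuation K (WithTop ℤ))
    {n c e : ℤ} (hn : 0 ≤ n) (he : e ≤ 1) {a : K} (ha : ((n * e : ℤ) : WithTop ℤ) ≤ v a)
    {f : K[X]} (hf : ∀ i : ℕ, ((n * (c - i) : ℤ) : WithTop ℤ) ≤ v (f.coeff i)) (i : ℕ) :
    ((n * (c + e - i) : ℤ) : WithTop ℤ) ≤ v (((X - C a) * f).coeff i) := by
  have hmul : ((n * (c + e - i) : ℤ) : WithTop ℤ) ≤ v (a * f.coeff i) := by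
    rw [v.map_mul, show n * (c + e - i) = n * e + n * (c - i) by ring, WithTop.coe_add]
    exact add_le_add ha (hf i)
  rw [sub_mul, coeff_sub, coeff_C_mul]
  refine v.map_le_sub ?_ hmul
  cases i with
  | zero => simp
  | succ i =>
    rw [coeff_X_mul]
    refine le_trans (WithTop.coe_le_coe.2 ?_) (hf i)
    push_cast
    exact mul_le_mul_of_nonneg_left (by linarith) hn

open Polynomial in
theorem AddValuation.le_coeff_prod_X_sub_C {K ι : Type*} [Field K] [DecidableEq ι]
    (v : AddValuation K (WithTop ℤ)) {n : ℤ} (hn : 0 ≤ n) {r : ι → K} {S : Finset ι}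
    (hr : ∀ m, 0 ≤ v (r m)) (hrS : ∀ m ∈ S, (n : WithTop ℤ) ≤ v (r m)) (T : Finset ι) (i : ℕ) :
    ((n * ((T ∩ S).card - i) : ℤ) : WithTop ℤ) ≤ v ((∏ m ∈ T, (X - C (r m))).coeff i) := by
  induction T using Finset.induction_on generalizing i with
  | empty =>
    rw [Finset.prod_empty, coeff_one]
    split_ifs with h
    · simp [h]
    · simp
  | insert a T ha ih =>
    rw [Finset.prod_insert ha]
    by_cases haS : a ∈ S
    · rw [Finset.insert_inter_of_mem haS,
        Finset.card_insert_of_notMem fun h => ha (Finset.mem_inter.1 h).1, Nat.cast_succ]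
      exact v.le_coeff_X_sub_C_mul hn le_rfl (by simpa using hrS a haS) ih i
    · rw [Finset.insert_inter_of_notMem haS]
      simpa only [add_zero] using
        v.le_coeff_X_sub_C_mul hn zero_le_one (by simpa using hr a) ih i

/-- If `f = ∏ (X - r_m)` where all `r_m` have valuation `≥ 0` and at least `C`
of them have valuation `≥ n`, then the coefficient of `X^i` in `f` has
valuation at least `n * (C - i)`. -/
theorem stmt5 {K : Type*} [Field K] (v : AddValuation K (WithTop ℤ))
    (n : ℤ) (hn : 0 ≤ n) (C D : ℕ) (hCD : C ≤ D)
    (r : Fin D → K) (hr : ∀ m, (0 : WithTop ℤ) ≤ v (r m))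
    (S : Finset (Fin D)) (hS : S.card = C)
    (hrS : ∀ m ∈ S, (n : WithTop ℤ) ≤ v (r m)) :
    ∀ i ≤ D, ((n * ((C : ℤ) - (i : ℤ)) : ℤ) : WithTop ℤ) ≤
      v ((∏ m, (Polynomial.X - Polynomial.C (r m))).coeff i) := by
  intro i _
  simpa [hS] using v.le_coeff_prod_X_sub_C hn hr hrS Finset.univ i
end

section
/- Let D ≥ 1, n ≥ 1 and 0 ≤ C ≤ D be integers, let J ∈ A, and let Φ(X,Y) ∈ A[X,Y] be a polynomial that is monic of degree D in X and has degree at most D in Y. Write Φ(X + J, Y + J) = Σ_{i,j} a_{i,j}·X^i·Y^j. Suppose there exist y_0, y_1, …, y_D ∈ K with v(y_k) = n for all k and v(y_k − y_l) = n for all k ≠ l, such that for each k the one-variable polynomial Φ(X, y_k + J) ∈ K[X] splits as ∏_{m=1}^{D} (X − z_{k,m}) with all z_{k,m} ∈ A, and at least C of the D values z_{k,1} − J, …, z_{k,D} − J have valuation v ≥ n. Then v(a_{i,j}) ≥ n·(C − i − j) for all pairs (i, j) with i + j < C. -/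
open Polynomial

/-- A polynomial `p` has Gauss weight at least `w`, with respect to the slope `n`, if
`v (p.coeff i) ≥ n * (w - i)` for all `i`. -/
def GaussWeightGE {K : Type*} [Field K] (v : AddValuation K (WithTop ℤ)) (n w : ℤ)
    (p : K[X]) : Prop :=
  ∀ i : ℕ, ((n * (w - i) : ℤ) : WithTop ℤ) ≤ v (p.coeff i)

namespace GaussWeightGE

variable {K : Type*} [Field K] {v : AddValuation K (WithTop ℤ)} {n w w' : ℤ} {p q : K[X]}

theorem mono (hn : 0 ≤ n) (hw : w' ≤ w) (hp : GaussWeightGE v n w p) :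
    GaussWeightGE v n w' p := fun i =>
  le_trans (WithTop.coe_le_coe.2 (mul_le_mul_of_nonneg_left (by lia) hn)) (hp i)

theorem mul (hp : GaussWeightGE v n w p) (hq : GaussWeightGE v n w' q) :
    GaussWeightGE v n (w + w') (p * q) := by
  intro i
  rw [coeff_mul]
  refine AddValuation.map_le_sum v fun x hx => ?_
  rw [← Finset.HasAntidiagonal.mem_antidiagonal.1 hx, AddValuation.map_mul]
  refine le_trans (le_of_eq ?_) (add_le_add (hp x.1) (hq x.2))
  rw [← WithTop.coe_add, WithTop.coe_inj]
  push_cast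
  ring

theorem sum {ι : Type*} {s : Finset ι} {f : ι → K[X]}
    (hf : ∀ k ∈ s, GaussWeightGE v n w (f k)) : GaussWeightGE v n w (∑ k ∈ s, f k) := by
  intro i
  rw [finsetSum_coeff]
  exact AddValuation.map_le_sum v fun k hk => hf k hk i

theorem C {c : K} (hc : ((n * w : ℤ) : WithTop ℤ) ≤ v c) :
    GaussWeightGE v n w (Polynomial.C c) := by
  intro i
  rw [coeff_C]
  split_ifs with h
  · simpa [h] using hc
  · simp

theorem prod {ι : Type*} {s : Finset ι} {f : ι → K[X]} {W : ι → ℤ}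
    (hf : ∀ k ∈ s, GaussWeightGE v n (W k) (f k)) :
    GaussWeightGE v n (∑ k ∈ s, W k) (∏ k ∈ s, f k) := by
  classical
  induction s using Finset.induction_on with
  | empty => simpa using C (v := v) (w := 0) (n := n) (c := (1 : K)) (by simp)
  | insert a s ha ih =>
    rw [Finset.sum_insert ha, Finset.prod_insert ha]
    exact (hf a (Finset.mem_insert_self a s)).mul
      (ih fun k hk => hf k (Finset.mem_insert_of_mem hk))

theorem X_sub_C {r : K} (hn : 0 ≤ n) (hw : w ≤ 1) (hr : ((n * w : ℤ) : WithTop ℤ) ≤ v r) :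
    GaussWeightGE v n w (X - Polynomial.C r) := by
  intro i
  rw [coeff_sub, coeff_X, coeff_C]
  rcases i with _ | _ | i
  · simpa [AddValuation.map_neg] using hr
  · have h : n * (w - 1) ≤ 0 := mul_nonpos_of_nonneg_of_nonpos hn (by lia)
    simpa using WithTop.coe_le_coe.2 h
  · simp

/-- A product of linear factors with integral roots has Gauss weight at least the number
of roots of valuation at least `n`. -/
theorem prod_X_sub_C {ι : Type*} [Fintype ι] {r : ι → K} {S : Finset ι} (hn : 0 ≤ n)
    (hr : ∀ m, 0 ≤ v (r m)) (hS : ∀ m ∈ S, (n : WithTop ℤ) ≤ v (r m)) :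
    GaussWeightGE v n S.card (∏ m, (X - Polynomial.C (r m))) := by
  classical
  have h := prod (v := v) (s := Finset.univ) (f := fun m => X - Polynomial.C (r m))
    (W := fun m => if m ∈ S then 1 else 0) fun m _ => by
      refine X_sub_C hn (by split_ifs <;> simp) ?_
      split_ifs with hm
      · simpa using hS m hm
      · simpa using hr m
  simpa using h

theorem basisDivisor {x y : K} (hn : 0 ≤ n) (hy : (n : WithTop ℤ) ≤ v y)
    (hxy : v (x - y) = (n : WithTop ℤ)) : GaussWeightGE v n 0 (Lagrange.basisDivisor x y) := by
  have hne : x - y ≠ 0 := by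
    intro h
    simp [h] at hxy
  have hinv : ((n * (-1) : ℤ) : WithTop ℤ) ≤ v (x - y)⁻¹ := by
    have h : v (x - y) + v (x - y)⁻¹ = 0 := by
      rw [← AddValuation.map_mul, mul_inv_cancel₀ hne, AddValuation.map_one]
    rw [hxy] at h
    generalize v (x - y)⁻¹ = a at h ⊢
    induction a using WithTop.recTopCoe with
    | top => exact le_top
    | coe a =>
      norm_cast at h ⊢
      lia
  exact (C hinv).mul (X_sub_C hn le_rfl (by simpa using hy))

/-- A polynomial of small degree whose values at sufficiently many points, all of valuation `n`
and pairwise at distance exactly `n`, have valuation at least `n * w`, has Gauss weight at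
least `w`. -/
theorem of_eval {ι : Type*} [Fintype ι] {y : ι → K} (hn : 0 ≤ n)
    (hy : ∀ k, (n : WithTop ℤ) ≤ v (y k))
    (hyy : ∀ k l, k ≠ l → v (y k - y l) = (n : WithTop ℤ))
    (hdeg : p.degree < Fintype.card ι)
    (hp : ∀ k, ((n * w : ℤ) : WithTop ℤ) ≤ v (p.eval (y k))) : GaussWeightGE v n w p := by
  classical
  have hinj : Set.InjOn y (Finset.univ : Finset ι) := by
    intro k _ l _ h
    by_contra hkl
    simpa [h] using hyy k l hkl
  rw [Lagrange.eq_interpolate hinj hdeg, Lagrange.interpolate_apply]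
  refine sum fun k _ => ?_
  have hbasis : GaussWeightGE v n 0 (Lagrange.basis Finset.univ y k) := by
    simpa [Lagrange.basis] using prod (W := fun _ => 0) fun l hl =>
      basisDivisor hn (hy l) (hyy k l (Finset.ne_of_mem_erase hl).symm)
  simpa using (C (hp k)).mul hbasis

end GaussWeightGE

/-- Translating the outer variable by a constant does not raise the degree in the inner
variable. -/
theorem natDegree_coeff_comp_X_add_C_C_le {R : Type*} [CommRing R] {P : R[X][X]} {d : ℕ}
    (hP : ∀ i, (P.coeff i).natDegree ≤ d) (a : R) (i : ℕ) :
    ((P.comp (X + C (C a))).coeff i).natDegree ≤ d := by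
  rw [comp, eval₂_eq_sum_range, finsetSum_coeff]
  refine natDegree_sum_le_of_forall_le _ _ fun m _ => ?_
  rw [coeff_C_mul, coeff_X_add_C_pow, ← C_pow, ← C_eq_natCast, ← C_mul]
  exact (natDegree_mul_C_le _ _).trans (hP m)

/-- Main technical result on the shifted modular-type polynomial
`Φ(X + J, Y + J) = ∑ a_{i,j} X^i Y^j`: under the deformation hypotheses, the
coefficients satisfy `v (a_{i,j}) ≥ n * (C - i - j)` for `i + j < C`.

Here `Φ` is a bivariate polynomial, encoded as `Polynomial (Polynomial K)` with
outer variable `X` and inner variable `Y`; the substitution `Y ↦ Y + J` is given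
by mapping coefficients via `eval₂RingHom C (X + C J)`, and `X ↦ X + J` by
composition with `X + C (C J)`. -/
theorem stmt6 {K : Type*} [Field K] (v : AddValuation K (WithTop ℤ))
    (D : ℕ) (hD : 1 ≤ D) (n : ℤ) (hn : 1 ≤ n) (C : ℕ) (hC : C ≤ D)
    (J : K) (hJ : (0 : WithTop ℤ) ≤ v J)
    (Φ : Polynomial (Polynomial K))
    (hΦA : ∀ i j : ℕ, (0 : WithTop ℤ) ≤ v ((Φ.coeff i).coeff j))
    (hmonic : Φ.Monic) (hdegX : Φ.natDegree = D)
    (hdegY : ∀ i : ℕ, (Φ.coeff i).natDegree ≤ D)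
    (y : Fin (D + 1) → K)
    (hy : ∀ k, v (y k) = (n : WithTop ℤ))
    (hyy : ∀ k l, k ≠ l → v (y k - y l) = (n : WithTop ℤ))
    (hz : ∀ k : Fin (D + 1), ∃ z : Fin D → K,
      Φ.map (Polynomial.evalRingHom (y k + J)) =
        ∏ m : Fin D, (Polynomial.X - Polynomial.C (z m)) ∧
      (∀ m, (0 : WithTop ℤ) ≤ v (z m)) ∧
      ∃ S : Finset (Fin D), C ≤ S.card ∧ ∀ m ∈ S, (n : WithTop ℤ) ≤ v (z m - J)) :
    ∀ i j : ℕ, i + j < C →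
      ((n * ((C : ℤ) - (i : ℤ) - (j : ℤ)) : ℤ) : WithTop ℤ) ≤
        v ((((Φ.map (Polynomial.eval₂RingHom (Polynomial.C : K →+* Polynomial K)
                (Polynomial.X + Polynomial.C J))).comp
              (Polynomial.X + Polynomial.C (Polynomial.C J))).coeff i).coeff j) := by
  intro i j _
  have hn0 : 0 ≤ n := by lia
  set P := Φ.map (Polynomial.eval₂RingHom (Polynomial.C : K →+* Polynomial K)
    (Polynomial.X + Polynomial.C J)) with hP
  have hPdeg : ∀ m, (P.coeff m).natDegree ≤ D := fun m => by
    rw [hP, coeff_map, coe_eval₂RingHom]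
    change ((Φ.coeff m).comp (X + Polynomial.C J)).natDegree ≤ D
    rw [natDegree_comp, natDegree_X_add_C, mul_one]
    exact hdegY m
  have hdeg : ((P.comp (X + Polynomial.C (Polynomial.C J))).coeff i).degree <
      Fintype.card (Fin (D + 1)) := by
    rw [Fintype.card_fin]
    refine lt_of_le_of_lt degree_le_natDegree (WithBot.coe_lt_coe.2 ?_)
    exact Nat.lt_succ_of_le (natDegree_coeff_comp_X_add_C_C_le hPdeg J i)
  have hval : ∀ k, ((n * ((C : ℤ) - i) : ℤ) : WithTop ℤ) ≤
      v (((P.comp (X + Polynomial.C (Polynomial.C J))).coeff i).eval (y k)) := fun k => by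
    obtain ⟨z, hfac, hz0, S, hCS, hS⟩ := hz k
    have hring : (evalRingHom (y k)).comp (eval₂RingHom (Polynomial.C : K →+* K[X])
        (X + Polynomial.C J)) = evalRingHom (y k + J) := by
      ext <;> simp
    have hspec : (P.comp (X + Polynomial.C (Polynomial.C J))).map (evalRingHom (y k)) =
        ∏ m : Fin D, (X - Polynomial.C (z m - J)) := by
      rw [map_comp, hP, Polynomial.map_map, hring, hfac, prod_comp]
      refine Finset.prod_congr rfl fun m _ => ?_
      simp only [Polynomial.map_add, map_X, map_C, coe_evalRingHom, eval_C, sub_comp, X_comp,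
        C_comp, C_sub]
      ring
    rw [← coe_evalRingHom, ← coeff_map, hspec]
    exact (GaussWeightGE.prod_X_sub_C hn0
      (fun m => (le_min (hz0 m) hJ).trans (AddValuation.map_sub v _ _)) hS).mono hn0
      (by exact_mod_cast hCS) i
  exact GaussWeightGE.of_eval hn0 (fun k => (hy k).ge) hyy hdeg hval j
end

section
/- There exists a real constant C > 0 such that for every integer N ≥ 3, Σ_{p prime, p ∣ N} ((p^{e_p} − 1)/(p^{e_p − 1}·(p² − 1)))·log p ≤ C·log(log N), where e_p = v_p(N) denotes the exponent of p in the prime factorization of N. -/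
theorem Nat.pow_div_dvd_factorial {p : ℕ} (hp : 0 < p) (n : ℕ) : p ^ (n / p) ∣ n.factorial := by
  have key (k : ℕ) : p ^ k ∣ (p * k).factorial := by
    induction k with
    | zero => simp
    | succ k ih =>
      rw [pow_succ, Nat.mul_succ]
      exact (mul_dvd_mul ih (Nat.dvd_factorial hp le_rfl)).trans
        (Nat.factorial_mul_factorial_dvd_factorial_add _ _)
  exact (key (n / p)).trans (Nat.factorial_dvd_factorial (Nat.mul_div_le n p))

/-- The upper bound in Mertens' first theorem. -/
theorem Nat.sum_primesLE_log_div_le {n : ℕ} (hn : 0 < n) :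
    ∑ p ∈ n.primesLE, Real.log p / p ≤ Real.log n + Real.log 4 := by
  have hn' : (0 : ℝ) < n := by exact_mod_cast hn
  have hfact : ∑ p ∈ n.primesLE, ((n / p : ℕ) : ℝ) * Real.log p ≤ n * Real.log n := by
    have hle : Real.log n.factorial ≤ n * Real.log n := by
      rw [← Real.log_pow]
      exact Real.log_le_log (by exact_mod_cast n.factorial_pos)
        (by exact_mod_cast n.factorial_le_pow)
    rw [Real.log_nat_eq_sum_factorization, Finsupp.sum, Nat.support_factorization] at hle
    refine le_trans ?_ hle
    have hsub : n.primesLE ⊆ n.factorial.primeFactors := by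
      intro p hp
      obtain ⟨hpn, hp⟩ := Nat.mem_primesLE.mp hp
      exact Nat.mem_primeFactors.mpr
        ⟨hp, Nat.dvd_factorial hp.pos hpn, n.factorial_ne_zero⟩
    refine le_trans (Finset.sum_le_sum fun p hp ↦ ?_)
      (Finset.sum_le_sum_of_subset_of_nonneg hsub fun p _ _ ↦ by positivity)
    have hp := (Nat.mem_primesLE.mp hp).2
    gcongr
    exact (hp.pow_dvd_iff_le_factorization n.factorial_ne_zero).mp
      (Nat.pow_div_dvd_factorial hp.pos n)
  have htheta := Chebyshev.theta_le_log4_mul_x hn'.le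
  rw [Chebyshev.theta_eq_sum_primesLE_log] at htheta
  have hsum : n * ∑ p ∈ n.primesLE, Real.log p / p
      ≤ ∑ p ∈ n.primesLE, (((n / p : ℕ) : ℝ) * Real.log p + Real.log p) := by
    rw [Finset.mul_sum]
    refine Finset.sum_le_sum fun p _ ↦ ?_
    have hfloor : (n : ℝ) / p ≤ ((n / p : ℕ) : ℝ) + 1 := by
      rw [← Nat.floor_div_eq_div (K := ℝ)]
      exact (Nat.lt_floor_add_one _).le
    calc (n : ℝ) * (Real.log p / p) = n / p * Real.log p := by ring
      _ ≤ (((n / p : ℕ) : ℝ) + 1) * Real.log p := by gcongr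
      _ = _ := by ring
  rw [Finset.sum_add_distrib] at hsum
  refine le_of_mul_le_mul_left ?_ hn'
  linarith

theorem Nat.sum_primeFactors_log_le {N : ℕ} (hN : N ≠ 0) :
    ∑ p ∈ N.primeFactors, Real.log p ≤ Real.log N := by
  rw [← Real.log_prod fun p hp ↦ by
    exact_mod_cast (Nat.prime_of_mem_primeFactors hp).ne_zero, ← Nat.cast_prod]
  have hpos : 0 < ∏ p ∈ N.primeFactors, p :=
    Finset.prod_pos fun p hp ↦ (Nat.prime_of_mem_primeFactors hp).pos
  exact Real.log_le_log (by exact_mod_cast hpos)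
    (by exact_mod_cast Nat.le_of_dvd (Nat.pos_of_ne_zero hN) N.prod_primeFactors_dvd)

theorem Nat.sum_primeFactors_log_div_le {N : ℕ} (hN : 1 ≤ Real.log N) :
    ∑ p ∈ N.primeFactors, Real.log p / p ≤ Real.log (Real.log N) + Real.log 4 + 1 := by
  have hN0 : N ≠ 0 := by rintro rfl; norm_num at hN
  have hy : 0 < Real.log N := by linarith
  set n := ⌊Real.log N⌋₊ with hn_def
  have hn : 0 < n := Nat.floor_pos.mpr hN
  rw [← Finset.sum_filter_add_sum_filter_not N.primeFactors (· ≤ n)]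
  refine _root_.add_le_add ?_ ?_
  · calc ∑ p ∈ N.primeFactors with p ≤ n, Real.log p / p
        ≤ ∑ p ∈ n.primesLE, Real.log p / p := by
          refine Finset.sum_le_sum_of_subset_of_nonneg (fun p hp ↦ ?_) fun p _ _ ↦ by positivity
          rw [Finset.mem_filter] at hp
          exact Nat.mem_primesLE.mpr ⟨hp.2, Nat.prime_of_mem_primeFactors hp.1⟩
      _ ≤ Real.log n + Real.log 4 := Nat.sum_primesLE_log_div_le hn
      _ ≤ _ := by
          gcongr
          exact Nat.floor_le hy.le
  · calc ∑ p ∈ N.primeFactors with ¬ p ≤ n, Real.log p / p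
        ≤ ∑ p ∈ N.primeFactors with ¬ p ≤ n, Real.log p / Real.log N := by
          refine Finset.sum_le_sum fun p hp ↦ ?_
          have hp := (Nat.floor_lt hy.le).mp (not_le.mp (Finset.mem_filter.mp hp).2)
          gcongr
      _ ≤ ∑ p ∈ N.primeFactors, Real.log p / Real.log N :=
          Finset.sum_le_sum_of_subset_of_nonneg (Finset.filter_subset _ _)
            fun p _ _ ↦ by positivity
      _ ≤ 1 := by
          rw [← Finset.sum_div]
          exact div_le_one_of_le₀ (Nat.sum_primeFactors_log_le hN0) hy.le

theorem pow_sub_one_div_le_two_div {x : ℝ} (hx : 2 ≤ x) {e : ℕ} (he : e ≠ 0) :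
    (x ^ e - 1) / (x ^ (e - 1) * (x ^ 2 - 1)) ≤ 2 / x := by
  obtain ⟨k, rfl⟩ := Nat.exists_eq_succ_of_ne_zero he
  have hsq : 0 < x ^ 2 - 1 := by nlinarith
  have hk : 0 < x ^ k := by positivity
  simp only [Nat.succ_eq_add_one, Nat.add_sub_cancel]
  rw [div_le_div_iff₀ (by positivity) (by linarith), pow_succ]
  nlinarith [mul_nonneg hk.le (show 0 ≤ x ^ 2 - 2 by nlinarith)]

/-- `λ_N = ∑_{p ∣ N} ((p^{e_p} - 1) / (p^{e_p - 1} (p² - 1))) log p = O(log log N)`. -/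
theorem stmt9 : ∃ C : ℝ, 0 < C ∧ ∀ N : ℕ, 3 ≤ N →
    ∑ p ∈ N.primeFactors,
      (((p : ℝ) ^ (N.factorization p) - 1) /
        ((p : ℝ) ^ (N.factorization p - 1) * ((p : ℝ) ^ 2 - 1))) * Real.log p
      ≤ C * Real.log (Real.log N) := by
  have hlog3 : 1 < Real.log 3 := by
    rw [Real.lt_log_iff_exp_lt (by norm_num)]
    linarith [Real.exp_one_lt_d9]
  have hc : 0 < Real.log (Real.log 3) := Real.log_pos hlog3
  have hlog4 : 0 < Real.log 4 := Real.log_pos (by norm_num)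
  set c := Real.log (Real.log 3)
  refine ⟨2 * (1 + (Real.log 4 + 1) / c), by positivity, fun N hN ↦ ?_⟩
  have hlogN : Real.log 3 ≤ Real.log N :=
    Real.log_le_log (by norm_num) (by exact_mod_cast hN)
  have hcN : c ≤ Real.log (Real.log N) := Real.log_le_log (by linarith) hlogN
  calc _ ≤ ∑ p ∈ N.primeFactors, 2 * (Real.log p / p) := by
        refine Finset.sum_le_sum fun p hp ↦ ?_
        have hprime := Nat.prime_of_mem_primeFactors hp
        have hp2 : (2 : ℝ) ≤ p := by exact_mod_cast hprime.two_le
        have he : N.factorization p ≠ 0 := by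
          rwa [← Finsupp.mem_support_iff, Nat.support_factorization]
        calc _ ≤ 2 / (p : ℝ) * Real.log p := by
              exact mul_le_mul_of_nonneg_right (pow_sub_one_div_le_two_div hp2 he) (by positivity)
          _ = _ := by ring
    _ ≤ 2 * (Real.log (Real.log N) + (Real.log 4 + 1)) := by
        rw [← Finset.mul_sum]
        linarith [Nat.sum_primeFactors_log_div_le (N := N) (by linarith)]
    _ ≤ 2 * (Real.log (Real.log N) + (Real.log 4 + 1) / c * Real.log (Real.log N)) := by
        gcongr
        rw [div_mul_eq_mul_div, le_div_iff₀ hc]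
        gcongr
    _ = _ := by ring
end
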